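/- Let R be a Noetherian local ring of Krull dimension d with maximal ideal m and let I be an m-primary ideal. Then there exists a polynomial p of degree d with rational coefficients such that for all sufficiently large t, length(R/I^{t+1}) = p(t), and the leading coefficient of p is e(I)/d! where e(I) is the multiplicity of R with respect to I. -/

import Mathlib

open Filter

/-- `moduleLengthEq R M r` : the `R`-module `M` has finite length exactly `r`. -/
def moduleLengthEq (R M : Type*) [Ring R] [AddCommGroup M] [Module R M] (r : ℕ) : Prop :=
  ∃ s : CompositionSeries (Submodule R M), s.head = ⊥ ∧ s.last = ⊤ ∧ s.length = r

namespace HSam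

section len
variable {R : Type*} [CommRing R]

/-- colength of an ideal -/
noncomputable def co (J : Ideal R) : ℕ := (Module.length R (R ⧸ J)).toNat

def FL (J : Ideal R) : Prop := Module.length R (R ⧸ J) ≠ ⊤

lemma length_mono {A B : Ideal R} (h : A ≤ B) :
    Module.length R (R ⧸ B) ≤ Module.length R (R ⧸ A) :=
  Module.length_le_of_surjective (Submodule.factor h) (Submodule.factor_surjective h)

lemma FL.mono {A B : Ideal R} (h : A ≤ B) (hA : FL A) : FL B :=
  ne_top_of_le_ne_top hA (length_mono h)

lemma co_mono {A B : Ideal R} (h : A ≤ B) (hA : FL A) : co B ≤ co A :=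
  ENat.toNat_le_toNat (length_mono h) hA

lemma length_add {A B : Ideal R} (h : A ≤ B) {M : Type*} [AddCommGroup M] [Module R M]
    (g : M →ₗ[R] R ⧸ A) (hg : LinearMap.range g = Submodule.map A.mkQ B) :
    Module.length R (R ⧸ A) =
      Module.length R (M ⧸ LinearMap.ker g) + Module.length R (R ⧸ B) := by
  rw [g.quotKerEquivRange.length_eq]
  refine Module.length_eq_add_of_exact (LinearMap.range g).subtype (Submodule.factor h)
    (Submodule.subtype_injective _) (Submodule.factor_surjective h) ?_
  rw [LinearMap.exact_iff, Submodule.range_subtype, hg]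
  ext y
  obtain ⟨y, rfl⟩ := A.mkQ_surjective y
  simp only [LinearMap.mem_ker, Submodule.mem_map]
  constructor
  · intro hy
    refine ⟨y, ?_, rfl⟩
    exact (Submodule.Quotient.mk_eq_zero B).1 hy
  · rintro ⟨z, hz, hzy⟩
    rw [← hzy]
    exact (Submodule.Quotient.mk_eq_zero B).2 hz

lemma length_colon {N N' K D : Ideal R} (x : R) (hK : ∀ y, y ∈ K ↔ y ∈ N ∧ x * y ∈ N')
    (hD : D = N' ⊔ Submodule.map (LinearMap.lsmul R R x) N) :
    Module.length R (R ⧸ N') + Module.length R (R ⧸ N) =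
      Module.length R (R ⧸ K) + Module.length R (R ⧸ D) := by
  let g : N →ₗ[R] R ⧸ N' := N'.mkQ ∘ₗ (LinearMap.lsmul R R x) ∘ₗ N.subtype
  let k : N →ₗ[R] R ⧸ K := K.mkQ ∘ₗ N.subtype
  have h1 := length_add (A := N') (B := D) (by rw [hD]; exact le_sup_left) g (by
    simp only [g, LinearMap.range_comp, Submodule.range_subtype, hD, Submodule.map_sup]
    simp)
  have h2 := length_add (A := K) (B := N) (fun y hy => ((hK y).1 hy).1) k (by
    simp only [k, LinearMap.range_comp, Submodule.range_subtype])
  have h3 : LinearMap.ker g = LinearMap.ker k := by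
    ext ⟨y, hy⟩
    simp only [g, k, LinearMap.mem_ker, LinearMap.comp_apply, Submodule.mkQ_apply,
      Submodule.Quotient.mk_eq_zero, hK, Submodule.subtype_apply, hy, true_and,
      LinearMap.lsmul_apply, smul_eq_mul]
  rw [h1, h2, h3]
  ring

lemma co_colon {N N' K D : Ideal R} (x : R) (hK : ∀ y, y ∈ K ↔ y ∈ N ∧ x * y ∈ N')
    (hD : D = N' ⊔ Submodule.map (LinearMap.lsmul R R x) N) (h1 : FL N') (h2 : FL N) (h3 : FL K)
    (h4 : FL D) : co N' + co N = co K + co D := by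
  have := congrArg ENat.toNat (length_colon x hK hD)
  rwa [ENat.toNat_add h1 h2, ENat.toNat_add h3 h4] at this

lemma FL_of_pow [IsLocalRing R] [IsNoetherianRing R] {J : Ideal R}
    (h : ∃ s : ℕ, IsLocalRing.maximalIdeal R ^ s ≤ J) : FL J := by
  obtain ⟨s, hs⟩ := h
  by_cases hJ : J = ⊤
  · subst hJ
    have : Subsingleton (R ⧸ (⊤ : Ideal R)) := Ideal.Quotient.subsingleton_iff.2 rfl
    simp [FL]
  have : IsArtinianRing (R ⧸ J) := by
    apply IsLocalRing.quotient_artinian_of_mem_minimalPrimes_of_isLocalRing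
    refine ⟨⟨inferInstance, IsLocalRing.le_maximalIdeal hJ⟩, ?_⟩
    rintro q ⟨hq, hJq⟩ -
    exact hq.le_of_pow_le (hs.trans hJq)
  have : IsArtinian R (R ⧸ J) :=
    isArtinian_of_surjective_algebraMap (R := R ⧸ J) Ideal.Quotient.mk_surjective
  exact Module.length_ne_top

lemma co_pos {J : Ideal R} (h : FL J) (hJ : J ≠ ⊤) : 0 < co J := by
  have : Nontrivial (R ⧸ J) := Ideal.Quotient.nontrivial_iff.2 hJ
  have := Module.length_pos (R := R) (M := R ⧸ J)
  rw [co, Nat.pos_iff_ne_zero, Ne, ENat.toNat_eq_zero]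
  rintro (h' | h')
  · exact this.ne' h'
  · exact h h'

end len

section stab
variable {R : Type*} [CommRing R]

lemma mul_pow_le {I : Ideal R} {N : ℕ → Ideal R} (hN : ∀ i, I * N i ≤ N (i + 1)) (i j : ℕ) :
    I ^ i * N j ≤ N (i + j) := by
  induction i with
  | zero => simp
  | succ i ih =>
    rw [pow_succ', mul_assoc, add_right_comm]
    exact (Ideal.mul_mono_right ih).trans (hN _)

/-- ideal of the Rees algebra attached to a sequence -/
def reesIdeal (I : Ideal R) (N : ℕ → Ideal R) (hN : ∀ i, I * N i ≤ N (i + 1)) :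
    Ideal (reesAlgebra I) where
  carrier := {f | ∀ i, f.1.coeff i ∈ N i}
  add_mem' ha hb i := by simpa using (N i).add_mem (ha i) (hb i)
  zero_mem' i := by simp
  smul_mem' c f hf i := by
    simp only [smul_eq_mul, MulMemClass.coe_mul, Polynomial.coeff_mul]
    apply Ideal.sum_mem
    rintro ⟨j, k⟩ e
    rw [← Finset.HasAntidiagonal.mem_antidiagonal.mp e]
    exact mul_pow_le hN j k (Ideal.mul_mem_mul (c.2 j) (hf k))

lemma stable [IsNoetherianRing R] {I : Ideal R} {N : ℕ → Ideal R}
    (hN : ∀ i, I * N i ≤ N (i + 1)) (hI : ∀ i, N i ≤ I ^ i) :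
    ∃ k, ∀ i ≥ k, N (i + 1) ≤ I * N i := by
  let T : ℕ → ℕ → Ideal R := fun k i => if i ≤ k then N i else I ^ (i - k) * N k
  have hT : ∀ k i, I * T k i ≤ T k (i + 1) := by
    intro k i
    simp only [T]
    split_ifs with h1 h2 h2
    · exact hN i
    · obtain rfl : i = k := by omega
      simp
    · omega
    · rw [← mul_assoc, ← pow_succ', Nat.sub_add_comm (by omega)]
  have hmono : ∀ k i, T k i ≤ T (k + 1) i := by
    intro k i
    simp only [T]
    split_ifs with h1 h2 h2
    · exact le_rfl
    · omega
    · obtain rfl : i = k + 1 := by omega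
      simpa using hN k
    · obtain ⟨j, rfl⟩ : ∃ j, i = k + 1 + j := ⟨i - (k + 1), by omega⟩
      rw [show k + 1 + j - k = j + 1 by omega, show k + 1 + j - (k + 1) = j by omega, pow_succ,
        mul_assoc]
      exact Ideal.mul_mono_right (hN k)
  let F : ℕ →o Ideal (reesAlgebra I) :=
    ⟨fun k => reesIdeal I (T k) (hT k), monotone_nat_of_le_succ fun k f hf i => hmono k i (hf i)⟩
  obtain ⟨k, hk⟩ := monotone_stabilizes_iff_noetherian.2 (inferInstance : IsNoetherian _ _) F
  refine ⟨k, fun i hi a ha => ?_⟩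
  have hmem : (⟨Polynomial.monomial (i + 1) a, reesAlgebra.monomial_mem.2 (hI _ ha)⟩ :
      reesAlgebra I) ∈ F (i + 1) := by
    intro j
    simp only [Polynomial.coeff_monomial]
    split_ifs with h
    · subst h; simpa [T] using ha
    · simp
  rw [← hk (i + 1) (by omega)] at hmem
  have := hmem (i + 1)
  simp only [Polynomial.coeff_monomial, if_true, T] at this
  rw [if_neg (by omega)] at this
  rw [show i + 1 - k = (i - k) + 1 by omega, pow_succ', mul_assoc] at this
  refine Ideal.mul_mono_right ?_ this
  simpa [Nat.sub_add_cancel hi] using mul_pow_le hN (i - k) k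

end stab


/-- eventually polynomial of degree `< n` -/
def EP (n : ℕ) (g : ℕ → ℚ) : Prop :=
  ∃ p ∈ Polynomial.degreeLT ℚ n, ∀ᶠ t : ℕ in atTop, g t = p.eval (t : ℚ)

lemma EP.sub {n : ℕ} {g h : ℕ → ℚ} (hg : EP n g) (hh : EP n h) : EP n (fun t => g t - h t) := by
  obtain ⟨p, hp, h1⟩ := hg
  obtain ⟨q, hq, h2⟩ := hh
  refine ⟨p - q, Submodule.sub_mem _ hp hq, ?_⟩
  filter_upwards [h1, h2] with t a b
  simp [a, b]

lemma EP.shift {n : ℕ} {g : ℕ → ℚ} (hg : EP n g) : EP n (fun t => g (t + 1)) := by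
  obtain ⟨p, hp, h1⟩ := hg
  refine ⟨Polynomial.taylor 1 p, ?_, ?_⟩
  · rw [Polynomial.mem_degreeLT] at hp ⊢
    rwa [Polynomial.degree_taylor]
  · filter_upwards [(tendsto_add_atTop_nat 1).eventually h1] with t a
    simp [a, Polynomial.taylor_eval]

lemma exists_antidiff (n : ℕ) (p : Polynomial ℚ) (hp : p ∈ Polynomial.degreeLT ℚ n) :
    ∃ q ∈ Polynomial.degreeLT ℚ (n + 1), ∀ x : ℚ, q.eval (1 + x) - q.eval x = p.eval x := by
  refine ⟨∑ i ∈ Finset.range n, Polynomial.C (p.coeff i / (i + 1)) * Polynomial.bernoulli (i + 1),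
    ?_, fun x => ?_⟩
  · refine Submodule.sum_mem _ fun i hi => ?_
    rw [← Polynomial.smul_eq_C_mul]
    refine Submodule.smul_mem _ _ ?_
    rw [Polynomial.mem_degreeLT, Polynomial.degree_lt_iff_coeff_zero]
    intro m hm
    rw [Polynomial.coeff_bernoulli, if_neg]
    have := Finset.mem_range.1 hi
    omega
  · have : p.eval x = ∑ i ∈ Finset.range n, p.coeff i * x ^ i := by
      by_cases h0 : p = 0
      · simp [h0]
      · refine Polynomial.eval_eq_sum_range' ?_ x
        rw [Polynomial.mem_degreeLT] at hp
        exact (Polynomial.natDegree_lt_iff_degree_lt h0).2 hp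
    rw [this]
    simp only [Polynomial.eval_finsetSum, Polynomial.eval_mul, Polynomial.eval_C,
      Polynomial.bernoulli_eval_one_add]
    rw [← Finset.sum_sub_distrib]
    refine Finset.sum_congr rfl fun i _ => ?_
    have : (i : ℚ) + 1 ≠ 0 := by positivity
    push_cast
    field_simp
    ring

lemma EP.sum {n : ℕ} {g : ℕ → ℚ} (hg : EP n (fun t => g (t + 1) - g t)) : EP (n + 1) g := by
  obtain ⟨p, hp, h1⟩ := hg
  obtain ⟨q, hq, h2⟩ := exists_antidiff n p hp
  obtain ⟨k, hk⟩ := eventually_atTop.1 h1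
  refine ⟨q + Polynomial.C (g k - q.eval (k : ℚ)), Submodule.add_mem _ hq ?_, ?_⟩
  · rw [Polynomial.mem_degreeLT]
    exact lt_of_le_of_lt Polynomial.degree_C_le (by exact_mod_cast Nat.succ_pos n)
  · refine eventually_atTop.2 ⟨k, fun t ht => ?_⟩
    induction t, ht using Nat.le_induction with
    | base => simp
    | succ t ht ih =>
      have a := hk t ht
      have b := h2 t
      simp only [Polynomial.eval_add, Polynomial.eval_C] at ih ⊢
      push_cast
      rw [add_comm (t : ℚ) 1]
      linarith

lemma EP.congr {n : ℕ} {g h : ℕ → ℚ} (hg : EP n g) (hh : ∀ t, g t = h t) : EP n h := by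
  obtain rfl : g = h := funext hh
  exact hg

section hilb
variable {R : Type*} [CommRing R]

lemma hilbert [IsNoetherianRing R] {I : Ideal R} (S : Set R) (hS : I = Ideal.span S)
    (hFL : ∀ i, FL (I ^ (i + 1))) (T : Finset R) : ∀ (N N' : ℕ → Ideal R), (T : Set R) ⊆ S →
    (∀ i, I * N i ≤ N (i + 1)) → (∀ i, I * N' i ≤ N' (i + 1)) → (∀ i, N i ≤ I ^ i) →
    (∀ i, N' i ≤ N i) → (∀ i, I ^ (i + 1) ≤ N' i) →
    (∀ x ∈ S, x ∉ T → ∀ i, ∀ y ∈ N i, x * y ∈ N' (i + 1)) →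
    EP T.card (fun i => (co (N' i) : ℚ) - co (N i)) := by
  classical
  induction T using Finset.induction_on with
  | empty =>
    intro N N' _ hN hN' hNI hNN hIN hx
    obtain ⟨k, hk⟩ := stable hN hNI
    refine ⟨0, Submodule.zero_mem _, eventually_atTop.2 ⟨k + 1, fun t ht => ?_⟩⟩
    obtain ⟨t, rfl⟩ : ∃ s, t = s + 1 := ⟨t - 1, by omega⟩
    have : N' (t + 1) = N (t + 1) := by
      refine le_antisymm (hNN _) ((hk t (by omega)).trans ?_)
      rw [Ideal.mul_le]
      intro r hr y hy
      have : I ≤ Submodule.comap (LinearMap.mulRight R y) (N' (t + 1)) := by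
        rw [hS]
        exact Submodule.span_le.2 fun z hz => hx z hz (by simp) t y hy
      exact this hr
    simp [this]
  | insert x T hxT ih =>
    intro N N' hTS hN hN' hNI hNN hIN hx
    have hxS : x ∈ S := hTS (by simp)
    have hxI : x ∈ I := hS ▸ Ideal.subset_span hxS
    have hTS' : (T : Set R) ⊆ S := fun y hy => hTS (by simp [Finset.mem_coe.1 hy])
    let K : ℕ → Ideal R := fun i => N i ⊓ Submodule.comap (LinearMap.lsmul R R x) (N' (i + 1))
    have hK : ∀ i y, y ∈ K i ↔ y ∈ N i ∧ x * y ∈ N' (i + 1) := by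
      intro i y
      rfl
    let D : ℕ → Ideal R := fun i => Nat.casesOn i (N' 0)
      (fun j => N' (j + 1) ⊔ Submodule.map (LinearMap.lsmul R R x) (N j))
    have hDs : ∀ i, D (i + 1) = N' (i + 1) ⊔ Submodule.map (LinearMap.lsmul R R x) (N i) := fun i => rfl
    have hN'D : ∀ i, N' i ≤ D i := by
      rintro (_ | i)
      · exact le_rfl
      · exact le_sup_left
    have hxN : ∀ i, Submodule.map (LinearMap.lsmul R R x) (N i) ≤ N (i + 1) := by
      rintro i _ ⟨y, hy, rfl⟩
      exact hN i (Ideal.mul_mem_mul hxI hy)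
    have hDN : ∀ i, D i ≤ N i := by
      rintro (_ | i)
      · exact hNN 0
      · exact sup_le (hNN _) (hxN i)
    have hN'K : ∀ i, N' i ≤ K i := fun i y hy =>
      (hK i y).2 ⟨hNN i hy, hN' i (Ideal.mul_mem_mul hxI hy)⟩
    have hKN : ∀ i, K i ≤ N i := fun i => inf_le_left
    have hgK : ∀ i, I * K i ≤ K (i + 1) := by
      intro i
      rw [Ideal.mul_le]
      intro r hr y hy
      rw [hK] at hy ⊢
      refine ⟨hN i (Ideal.mul_mem_mul hr hy.1), ?_⟩
      rw [mul_left_comm]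
      exact hN' _ (Ideal.mul_mem_mul hr hy.2)
    have hgD : ∀ i, I * D i ≤ D (i + 1) := by
      rintro (_ | i)
      · exact (hN' 0).trans (hN'D 1)
      · rw [hDs, hDs, Ideal.mul_sup]
        refine sup_le_sup (hN' _) ?_
        rw [Ideal.mul_le]
        rintro r hr _ ⟨y, hy, rfl⟩
        refine ⟨r * y, hN i (Ideal.mul_mem_mul hr hy), ?_⟩
        simp [mul_left_comm]
    have e1 := ih K N' hTS' hgK hN' (fun i => (hKN i).trans (hNI i)) hN'K hIN (by
      intro z hz hzT i y hy
      by_cases hzx : z = x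
      · subst hzx
        exact ((hK i y).1 hy).2
      · exact hx z hz (by simp [hzx, hzT]) i y (hKN i hy))
    have e2 := ih N D hTS' hN hgD hNI hDN (fun i => (hIN i).trans (hN'D i)) (by
      intro z hz hzT i y hy
      by_cases hzx : z = x
      · subst hzx
        exact Submodule.mem_sup_right ⟨y, hy, rfl⟩
      · exact hN'D _ (hx z hz (by simp [hzx, hzT]) i y hy))
    rw [Finset.card_insert_of_notMem hxT]
    refine EP.sum ((e2.shift.sub e1).congr fun t => ?_)
    have fl' : ∀ i, FL (N' i) := fun i => (hFL i).mono (hIN i)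
    have := co_colon x (hK t) (hDs t) (fl' _) ((fl' _).mono (hNN _)) ((fl' _).mono (hN'K _))
      ((fl' (t + 1)).mono (hN'D (t + 1)))
    have : (co (N' (t + 1)) : ℚ) + co (N t) = co (K t) + co (D (t + 1)) := by exact_mod_cast this
    linarith

lemma samuel [IsNoetherianRing R] {I : Ideal R} (S : Finset R) (hS : I = Ideal.span S)
    (hFL : ∀ i, FL (I ^ (i + 1))) : EP (S.card + 1) (fun t => (co (I ^ (t + 1)) : ℚ)) := by
  refine EP.sum (EP.congr (EP.shift (hilbert (S : Set R) hS hFL S (fun i => I ^ i)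
    (fun i => I ^ (i + 1)) subset_rfl ?_ ?_ ?_ ?_ ?_ ?_)) ?_)
  · intro i; exact (pow_succ' I i).ge
  · intro i; exact (pow_succ' I (i + 1)).ge
  · intro i; exact le_rfl
  · intro i; exact Ideal.pow_le_pow_right (by omega)
  · intro i; exact le_rfl
  · intro x hx hx'; exact absurd hx hx'
  · intro t; rfl

end hilb

section lower
variable {R : Type*} [CommRing R]

lemma colon_le [IsNoetherianRing R] (I p : Ideal R) [p.IsPrime] {x : R} (hx : x ∉ p) :
    ∃ c : ℕ, 1 ≤ c ∧ ∀ t ≥ c, ∀ y, x * y ∈ I ^ t ⊔ p → y ∈ I ^ (t - c) ⊔ p := by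
  obtain ⟨c, hc⟩ := I.exists_pow_inf_eq_pow_smul (M := R ⧸ p)
    (LinearMap.range (LinearMap.lsmul R (R ⧸ p) x))
  have key : ∀ t ≥ c, ∀ y, x * y ∈ I ^ t ⊔ p → y ∈ I ^ (t - c) ⊔ p := by
    intro t ht y hy
    obtain ⟨a, ha, b, hb, hab⟩ := Submodule.mem_sup.1 hy
    have h1 : x • p.mkQ y ∈ I ^ t • (⊤ : Submodule R (R ⧸ p)) ⊓
        LinearMap.range (LinearMap.lsmul R (R ⧸ p) x) := by
      refine ⟨?_, ⟨p.mkQ y, rfl⟩⟩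
      have : x • p.mkQ y = a • p.mkQ 1 := by
        rw [← map_smul, ← map_smul, ← sub_eq_zero, ← map_sub, Submodule.mkQ_apply,
          Submodule.Quotient.mk_eq_zero, smul_eq_mul, smul_eq_mul, ← hab]
        simpa using hb
      rw [this]
      exact Submodule.smul_mem_smul ha trivial
    rw [hc t ht] at h1
    have h2 : x • p.mkQ y ∈ (I ^ (t - c) • (⊤ : Submodule R (R ⧸ p))).map
        (LinearMap.lsmul R (R ⧸ p) x) := by
      rw [Submodule.map_smul'', Submodule.map_top]
      exact Submodule.smul_mono le_rfl inf_le_right h1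
    obtain ⟨z, hz, hzy⟩ := h2
    have h3 : z ∈ Submodule.map p.mkQ (I ^ (t - c)) := by
      have : (I ^ (t - c) • (⊤ : Submodule R R)).map p.mkQ = I ^ (t - c) • ⊤ := by
        rw [Submodule.map_smul'', Submodule.map_top, Submodule.range_mkQ]
      rw [← this] at hz
      rwa [smul_eq_mul, Ideal.mul_top] at hz
    obtain ⟨w, hw, rfl⟩ := h3
    have h4 : x * (w - y) ∈ p := by
      rw [← smul_eq_mul, ← Submodule.Quotient.mk_eq_zero p, ← Submodule.mkQ_apply, map_smul,
        map_sub, smul_sub, sub_eq_zero]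
      exact hzy
    have h5 := (Ideal.IsPrime.mem_or_mem ‹_› h4).resolve_left hx
    have : y = w + -(w - y) := by ring
    rw [this]
    exact Submodule.add_mem_sup hw (p.neg_mem h5)
  refine ⟨c + 1, by omega, fun t ht y hy => ?_⟩
  have hle : I ^ (t - c) ⊔ p ≤ I ^ (t - (c + 1)) ⊔ p :=
    sup_le_sup_right (Ideal.pow_le_pow_right (by omega)) _
  exact hle (key t (by omega) y hy)

lemma step_ineq [IsNoetherianRing R] (I p q : Ideal R) [p.IsPrime] (hpq : p < q)
    (hFL : ∀ i, FL (I ^ i)) :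
    ∃ c : ℕ, 1 ≤ c ∧ ∀ t, co (I ^ t ⊔ p) + co (I ^ (t + c) ⊔ q) ≤ co (I ^ (t + c) ⊔ p) := by
  obtain ⟨x, hxq, hxp⟩ := SetLike.exists_of_lt hpq
  obtain ⟨c, hc1, hc⟩ := colon_le I p hxp
  refine ⟨c, hc1, fun t => ?_⟩
  let N' := I ^ (t + c) ⊔ p
  let K : Ideal R := Submodule.comap (LinearMap.lsmul R R x) N'
  let D : Ideal R := N' ⊔ Submodule.map (LinearMap.lsmul R R x) ⊤
  have fl : FL N' := (hFL _).mono le_sup_left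
  have hK : ∀ y, y ∈ K ↔ y ∈ (⊤ : Ideal R) ∧ x * y ∈ N' := fun y => by simp [K]
  have h1 : N' ≤ K := fun y hy => (hK y).2 ⟨trivial, N'.mul_mem_left _ hy⟩
  have := co_colon x hK (show D = _ from rfl) fl (fl.mono le_top) (fl.mono h1) (fl.mono (B := D) le_sup_left)
  have h2 : co (⊤ : Ideal R) = 0 := by
    have : Subsingleton (R ⧸ (⊤ : Ideal R)) := Ideal.Quotient.subsingleton_iff.2 rfl
    simp [co]
  have h3 : co (I ^ t ⊔ p) ≤ co K := co_mono (fun y hy => by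
    simpa using hc (t + c) (by omega) y ((hK y).1 hy).2) (fl.mono h1)
  have h4 : co (I ^ (t + c) ⊔ q) ≤ co D := co_mono (by
    refine sup_le (sup_le_sup_left hpq.le _) ?_
    rintro _ ⟨y, -, rfl⟩
    exact Submodule.mem_sup_right (q.mul_mem_right _ hxq)) (fl.mono le_sup_left)
  change _ ≤ co N'
  omega

end lower
section growth

lemma pow_diff (k : ℕ) {m : ℝ} (hm : 0 ≤ m) :
    (m + 1) ^ (k + 1) ≤ m ^ (k + 1) + (k + 1) * (m + 1) ^ k := by
  induction k with
  | zero => simp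
  | succ k ih =>
    have h1 : m ^ (k + 1) ≤ (m + 1) ^ (k + 1) := by gcongr; linarith
    have h2 : (m + 1) * (m + 1) ^ (k + 1) ≤
        (m + 1) * (m ^ (k + 1) + (k + 1) * (m + 1) ^ k) := by gcongr
    have e1 : (m + 1) ^ (k + 1 + 1) = (m + 1) * (m + 1) ^ (k + 1) := by ring
    have e2 : (m + 1) * (m ^ (k + 1) + (k + 1) * (m + 1) ^ k) =
      m ^ (k + 1 + 1) + m ^ (k + 1) + (k + 1) * (m + 1) ^ (k + 1) := by ring
    push_cast
    rw [e1]
    linarith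

lemma growth_step (k c : ℕ) (hc : 1 ≤ c) (g : ℕ → ℝ) (hg : ∀ t, 0 ≤ g t) (a : ℝ) (ha : 0 < a)
    (s : ℕ) (h : ∀ t ≥ s, g t + a * ((t + c : ℕ) : ℝ) ^ k ≤ g (t + c)) :
    ∃ b : ℝ, 0 < b ∧ ∃ s' : ℕ, ∀ t : ℕ, t ≥ s' → b * (t : ℝ) ^ (k + 1) ≤ g t := by
  have key : ∀ m r : ℕ, a / (k + 1) * (m : ℝ) ^ (k + 1) ≤ g (s + r + m * c) := by
    intro m r
    induction m with
    | zero => simpa using hg _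
    | succ m ih =>
      have h1 := h (s + r + m * c) (by omega)
      have h2 := pow_diff k (m := (m : ℝ)) (by positivity)
      have h3 : ((m : ℝ) + 1) ^ k ≤ ((s + r + m * c + c : ℕ) : ℝ) ^ k := by
        gcongr
        have : m + 1 ≤ s + r + m * c + c := by nlinarith
        exact_mod_cast this
      have h4 : a / (k + 1) * ((m : ℝ) + 1) ^ (k + 1) ≤
          a / (k + 1) * ((m : ℝ) ^ (k + 1) + (k + 1) * ((m : ℝ) + 1) ^ k) := by gcongr
      have h5 : a / (k + 1) * ((m : ℝ) ^ (k + 1) + (k + 1) * ((m : ℝ) + 1) ^ k) =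
        a / (k + 1) * (m : ℝ) ^ (k + 1) + a * ((m : ℝ) + 1) ^ k := by
        field_simp
      have h6 : a * ((m : ℝ) + 1) ^ k ≤ a * ((s + r + m * c + c : ℕ) : ℝ) ^ k := by gcongr
      rw [show s + r + (m + 1) * c = s + r + m * c + c by ring]
      push_cast at *
      linarith
  have hc' : (0 : ℝ) < c := by exact_mod_cast hc
  refine ⟨a / (k + 1) * (1 / (2 * c)) ^ (k + 1), by positivity, 2 * s + 2 * c, fun t ht => ?_⟩
  have h1 := key ((t - s) / c) ((t - s) % c)
  have h2 : s + (t - s) % c + (t - s) / c * c = t := by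
    have := Nat.mod_add_div' (t - s) c
    omega
  rw [h2] at h1
  refine le_trans ?_ h1
  rw [mul_assoc, ← mul_pow]
  gcongr
  have h3 : (t : ℝ) ≤ s + c + ((t - s) / c : ℕ) * c := by
    have := Nat.mod_lt (t - s) (show c > 0 by omega)
    have : t ≤ s + c + (t - s) / c * c := by omega
    exact_mod_cast this
  have h4 : (2 * s + 2 * c : ℝ) ≤ t := by exact_mod_cast ht
  rw [div_mul_eq_mul_div, one_mul, div_le_iff₀ (by positivity)]
  nlinarith

variable {R : Type*} [CommRing R]

lemma lower_chain [IsNoetherianRing R] [IsLocalRing R] (I : Ideal R)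
    (hIm : I ≤ IsLocalRing.maximalIdeal R)
    (hFL : ∀ i, FL (I ^ i)) (l : LTSeries (PrimeSpectrum R)) (j : ℕ) :
    ∀ i : ℕ, (hi : i + j = l.length) → ∃ b : ℝ, 0 < b ∧ ∃ s' : ℕ, ∀ t : ℕ, t ≥ s' →
      b * (t : ℝ) ^ j ≤ co (I ^ t ⊔ (l ⟨i, by omega⟩).asIdeal) := by
  induction j with
  | zero =>
    intro i hi
    refine ⟨1, one_pos, 1, fun t ht => ?_⟩
    have : 0 < co (I ^ t ⊔ (l ⟨i, by omega⟩).asIdeal) := by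
      refine co_pos ((hFL t).mono le_sup_left) (ne_top_of_le_ne_top
        (IsLocalRing.maximalIdeal.isMaximal R).ne_top (sup_le ?_ ?_))
      · exact (Ideal.pow_le_self (by omega)).trans hIm
      · exact IsLocalRing.le_maximalIdeal (l _).2.ne_top
    simpa using (Nat.one_le_iff_ne_zero.2 this.ne')
  | succ j ih =>
    intro i hi
    obtain ⟨a, ha, s, hs⟩ := ih (i + 1) (by omega)
    have hlt : l ⟨i, by omega⟩ < l ⟨i + 1, by omega⟩ := l.strictMono (by simp)
    obtain ⟨c, hc, h⟩ := step_ineq I (l ⟨i, by omega⟩).asIdeal (l ⟨i + 1, by omega⟩).asIdeal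
      hlt hFL
    refine growth_step j c hc (fun t => co (I ^ t ⊔ (l ⟨i, by omega⟩).asIdeal))
      (fun t => by positivity) a ha s (fun t ht => ?_)
    have h1 := hs (t + c) (by omega)
    have h2 : (co (I ^ t ⊔ (l ⟨i, by omega⟩).asIdeal) : ℝ) +
      co (I ^ (t + c) ⊔ (l ⟨i + 1, by omega⟩).asIdeal) ≤
      co (I ^ (t + c) ⊔ (l ⟨i, by omega⟩).asIdeal) := by exact_mod_cast h t
    simp only
    linarith

lemma lower [IsNoetherianRing R] [IsLocalRing R] (I : Ideal R)
    (hIm : I ≤ IsLocalRing.maximalIdeal R)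
    (hFL : ∀ i, FL (I ^ i)) (d : ℕ) (hd : ringKrullDim R = d) :
    ∃ b : ℝ, 0 < b ∧ ∃ s' : ℕ, ∀ t : ℕ, t ≥ s' → b * (t : ℝ) ^ d ≤ co (I ^ t) := by
  obtain ⟨l, hl⟩ := Order.le_krullDim_iff.1 (show (d : WithBot ℕ∞) ≤ Order.krullDim _ from hd.ge)
  obtain ⟨b, hb, s, hs⟩ := lower_chain I hIm hFL l d 0 (by omega)
  refine ⟨b, hb, s, fun t ht => (hs t ht).trans ?_⟩
  exact_mod_cast co_mono le_sup_left (hFL t)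

lemma exists_param [IsNoetherianRing R] [IsLocalRing R] (d : ℕ) (hd : ringKrullDim R = d) :
    ∃ S : Finset R, S.card = d ∧ Ideal.span (S : Set R) ≤ IsLocalRing.maximalIdeal R ∧
      ∃ s : ℕ, IsLocalRing.maximalIdeal R ^ s ≤ Ideal.span (S : Set R) := by
  obtain ⟨S, hS, hc⟩ :=
    (IsLocalRing.maximalIdeal R).exists_finset_card_eq_height_of_isNoetherianRing
  refine ⟨S, ?_, hS.1.2, ?_⟩
  · have := IsLocalRing.maximalIdeal_height_eq_ringKrullDim (R := R)
    rw [hd, ← hc] at this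
    exact_mod_cast this
  · refine Ideal.exists_pow_le_of_le_radical_of_fg ?_ (IsNoetherian.noetherian _)
    rw [Ideal.radical_eq_sInf]
    refine le_sInf fun J hJ => ?_
    exact hS.2 ⟨hJ.2, hJ.1⟩ (IsLocalRing.le_maximalIdeal hJ.2.ne_top)

end growth

section final
open Polynomial Asymptotics

lemma littleO_nat {p q : ℝ[X]} (h : p.degree < q.degree) :
    (fun t : ℕ => p.eval (t : ℝ)) =o[atTop] (fun t : ℕ => q.eval (t : ℝ)) :=
  (Polynomial.isLittleO_atTop_of_degree_lt p q h).comp_tendsto tendsto_natCast_atTop_atTop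

lemma degree_eq (P Q : ℝ[X]) (d : ℕ) (hQ : Q.degree ≤ d)
    (hPQ : ∀ᶠ t : ℕ in atTop, P.eval (t : ℝ) ≤ Q.eval (t : ℝ)) (b : ℝ) (hb : 0 < b)
    (hP : ∀ᶠ t : ℕ in atTop, b * (t : ℝ) ^ d ≤ P.eval (t : ℝ)) : P.degree = d := by
  have hpos : ∀ᶠ t : ℕ in atTop, 0 < (t : ℝ) ^ d := by
    filter_upwards [eventually_gt_atTop 0] with t ht
    positivity
  refine le_antisymm (not_lt.1 fun h => ?_) (not_lt.1 fun h => ?_)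
  · have h1 : (fun t : ℕ => P.eval (t : ℝ)) =O[atTop] (fun t : ℕ => Q.eval (t : ℝ)) := by
      refine IsBigO.of_bound 1 ?_
      filter_upwards [hPQ, hP, hpos] with t h1 h2 h3
      have : 0 < P.eval (t : ℝ) := lt_of_lt_of_le (by positivity) h2
      rw [Real.norm_of_nonneg this.le, Real.norm_of_nonneg (this.le.trans h1), one_mul]
      exact h1
    refine isLittleO_irrefl' ?_ (h1.trans_isLittleO (littleO_nat (hQ.trans_lt h)))
    refine Eventually.frequently ?_
    filter_upwards [hP, hpos] with t h2 h3
    have : 0 < P.eval (t : ℝ) := lt_of_lt_of_le (by positivity) h2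
    simpa using this.ne'
  · have h0 := littleO_nat (p := P) (q := X ^ d) (by simpa using h)
    have h1 : (fun t : ℕ => (X ^ d : ℝ[X]).eval (t : ℝ)) =O[atTop]
        (fun t : ℕ => P.eval (t : ℝ)) := by
      refine IsBigO.of_bound b⁻¹ ?_
      filter_upwards [hP, hpos] with t h2 h3
      have : 0 < P.eval (t : ℝ) := lt_of_lt_of_le (by positivity) h2
      rw [eval_pow, eval_X, Real.norm_of_nonneg this.le, Real.norm_of_nonneg h3.le,
        inv_mul_eq_div, le_div_iff₀ hb]
      linarith
    refine isLittleO_irrefl' ?_ (h1.trans_isLittleO h0)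
    refine Eventually.frequently ?_
    filter_upwards [hpos] with t h3
    rw [eval_pow, eval_X, Real.norm_of_nonneg h3.le]
    exact h3.ne'

lemma eval_map_nat (p : ℚ[X]) (t : ℕ) :
    (p.map (algebraMap ℚ ℝ)).eval (t : ℝ) = ((p.eval (t : ℚ) : ℚ) : ℝ) := by
  have := Polynomial.eval_map_apply (p := p) (algebraMap ℚ ℝ) (t : ℚ)
  rwa [map_natCast] at this

end final
end HSam

/-- Hilbert–Samuel: for `R` Noetherian local of Krull dimension `d` and `I` an `m`-primary
ideal, the Samuel function `t ↦ length (R / I^(t+1))` is eventually given by a polynomial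
of degree `d` with rational coefficients, whose leading coefficient is `e(I)/d!`, where the
multiplicity `e(I)` is the limit of `d! · length(R/I^(t+1)) / t^d`. -/
theorem stmt3 {R : Type*} [CommRing R] [IsLocalRing R] [IsNoetherianRing R]
    (d : ℕ) (hd : ringKrullDim R = d) (I : Ideal R)
    (hIm : I ≤ IsLocalRing.maximalIdeal R)
    (hprim : ∃ s : ℕ, IsLocalRing.maximalIdeal R ^ s ≤ I)
    (ℓ : ℕ → ℕ) (hℓ : ∀ t, moduleLengthEq R (R ⧸ (I ^ (t + 1))) (ℓ t)) :
    ∃ p : Polynomial ℝ, p.degree = d ∧ (∀ i, ∃ q : ℚ, p.coeff i = (q : ℝ)) ∧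
      (∀ᶠ t in atTop, (ℓ t : ℝ) = p.eval (t : ℝ)) ∧
      Tendsto (fun t : ℕ => (d.factorial * ℓ t : ℝ) / (t : ℝ) ^ d) atTop
        (nhds (d.factorial * p.leadingCoeff)) := by
  obtain ⟨s, hs⟩ := hprim
  have hFLI : ∀ i, HSam.FL (I ^ i) := fun i =>
    HSam.FL_of_pow ⟨s * i, by rw [pow_mul]; exact Ideal.pow_right_mono hs i⟩
  have hco : ∀ t, ℓ t = HSam.co (I ^ (t + 1)) := by
    intro t
    obtain ⟨σ, h1, h2, h3⟩ := hℓ t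
    rw [HSam.co, ← Module.length_compositionSeries σ h1 h2, h3, ENat.toNat_natCast]
  -- polynomiality
  obtain ⟨S, hS⟩ := (IsNoetherian.noetherian I : I.FG)
  obtain ⟨p, -, hp⟩ := HSam.samuel S hS.symm (fun i => hFLI _)
  -- upper bound
  obtain ⟨T, hTc, hTm, u, hu⟩ := HSam.exists_param d hd
  set J : Ideal R := Ideal.span (T : Set R) with hJ
  have hFLJ : ∀ i, HSam.FL (J ^ i) := fun i =>
    HSam.FL_of_pow ⟨u * i, by rw [pow_mul]; exact Ideal.pow_right_mono hu i⟩
  obtain ⟨q, hq, hqe⟩ := HSam.samuel T hJ (fun i => hFLJ _)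
  rw [hTc, Polynomial.mem_degreeLT] at hq
  -- lower bound
  obtain ⟨b, hb, s', hlow⟩ := HSam.lower I hIm hFLI d hd
  let P : Polynomial ℝ := p.map (algebraMap ℚ ℝ)
  let L : Polynomial ℚ := Polynomial.C ((s + 1 : ℕ) : ℚ) * Polynomial.X + Polynomial.C (s : ℚ)
  let Q : Polynomial ℝ := (q.comp L).map (algebraMap ℚ ℝ)
  have hPe : ∀ᶠ t : ℕ in atTop, (ℓ t : ℝ) = P.eval (t : ℝ) := by
    filter_upwards [hp] with t ht
    have h1 : P.eval (t : ℝ) = ((p.eval (t : ℚ) : ℚ) : ℝ) :=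
      HSam.eval_map_nat p t
    rw [h1, ← ht, hco]
    simp
  have hQe : ∀ᶠ t : ℕ in atTop, (HSam.co (J ^ ((s + 1) * (t + 1))) : ℝ) = Q.eval (t : ℝ) := by
    have htend : Tendsto (fun t : ℕ => (s + 1) * t + s) atTop atTop :=
      tendsto_atTop_mono (fun t => by simp only [id]; nlinarith [Nat.zero_le (s * t)]) tendsto_id
    filter_upwards [htend.eventually hqe] with t ht
    have h1 : Q.eval (t : ℝ) = (((q.comp L).eval (t : ℚ) : ℚ) : ℝ) :=
      HSam.eval_map_nat (q.comp L) t
    have h2 : L.eval (t : ℚ) = (((s + 1) * t + s : ℕ) : ℚ) := by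
      simp [L]
    rw [h1, Polynomial.eval_comp, h2, ← ht]
    simp only [Rat.cast_natCast]
    congr 3
  have hQd : Q.degree ≤ d := by
    refine Polynomial.degree_map_le.trans ?_
    have h1 : q.natDegree ≤ d := by
      refine Polynomial.natDegree_le_iff_degree_le.2 ?_
      rw [Polynomial.degree_lt_iff_coeff_zero] at hq
      rw [Polynomial.degree_le_iff_coeff_zero]
      intro m hm
      exact hq m (by exact_mod_cast hm)
    refine Polynomial.natDegree_le_iff_degree_le.1 ?_
    refine Polynomial.natDegree_comp_le.trans ?_
    have h2 : L.natDegree ≤ 1 := Polynomial.natDegree_linear_le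
    calc _ ≤ d * 1 := Nat.mul_le_mul h1 h2
      _ = d := mul_one d
  have hPQ : ∀ᶠ t : ℕ in atTop, P.eval (t : ℝ) ≤ Q.eval (t : ℝ) := by
    filter_upwards [hPe, hQe] with t h1 h2
    rw [← h1, ← h2, hco]
    have hle : J ^ (s + 1) ≤ I :=
      (Ideal.pow_right_mono hTm _).trans ((Ideal.pow_le_pow_right (by omega)).trans hs)
    have : J ^ ((s + 1) * (t + 1)) ≤ I ^ (t + 1) := by
      rw [pow_mul]
      exact Ideal.pow_right_mono hle _
    exact_mod_cast HSam.co_mono this (hFLJ _)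
  have hPl : ∀ᶠ t : ℕ in atTop, b * (t : ℝ) ^ d ≤ P.eval (t : ℝ) := by
    filter_upwards [hPe, eventually_ge_atTop s'] with t h1 h2
    rw [← h1, hco]
    have h3 : b * (t : ℝ) ^ d ≤ b * ((t + 1 : ℕ) : ℝ) ^ d := by
      gcongr
      omega
    exact h3.trans (hlow (t + 1) (by omega))
  have hdeg := HSam.degree_eq P Q d hQd hPQ b hb hPl
  refine ⟨P, hdeg, fun i => ⟨p.coeff i, by simp [P]⟩, hPe, ?_⟩
  have ht := (Polynomial.div_tendsto_atTop_leadingCoeff_div_of_degree_eq P (Polynomial.X ^ d)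
    (by simpa using hdeg)).comp (tendsto_natCast_atTop_atTop (R := ℝ))
  have ht' := ht.const_mul (d.factorial : ℝ)
  simp only [Polynomial.leadingCoeff_X_pow, div_one] at ht'
  refine ht'.congr' ?_
  filter_upwards [hPe] with t h1
  simp [h1, mul_div_assoc]
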